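/- For every natural number m and every complex number d with Re(d) > 0, there holds ₃F₂(1/2 + m, 1/2 − m, d+1; 5/2 + m, d; 1) = (1 + (1 − 2m)/(2d)) · 3π (5/2)_m / (2^(2m+3) m!). -/

import Mathlib

open scoped Nat

/-- Pochhammer symbol `(x)_k = x (x+1) ⋯ (x+k-1)` for a complex number `x`. -/
noncomputable def poch (x : ℂ) (k : ℕ) : ℂ := (ascPochhammer ℂ k).eval x

/-- The generalized hypergeometric series
`ₚF_q(a₁,…,aₚ; b₁,…,b_q; z) = ∑ₖ ((a₁)ₖ ⋯ (aₚ)ₖ)/((b₁)ₖ ⋯ (b_q)ₖ) · zᵏ/k!`. -/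
noncomputable def hyp (a b : List ℂ) (z : ℂ) : ℂ :=
  ∑' k : ℕ, ((a.map (poch · k)).prod / (b.map (poch · k)).prod) * z ^ k / (k ! : ℂ)

open MeasureTheory

theorem poch_succ (x : ℂ) (k : ℕ) : poch x (k + 1) = poch x k * (x + k) :=
  ascPochhammer_succ_eval k x

theorem poch_zero (x : ℂ) : poch x 0 = 1 := by simp [poch]

theorem poch_succ' (x : ℂ) (k : ℕ) : x * poch (x + 1) k = poch x k * (x + k) := by
  induction k with
  | zero => simp [poch_zero]
  | succ k ih =>
    rw [poch_succ, poch_succ, ← mul_assoc, ih]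
    push_cast
    ring

theorem poch_ne_zero {x : ℂ} (hx : 0 < x.re) (k : ℕ) : poch x k ≠ 0 := by
  induction k with
  | zero => simp [poch_zero]
  | succ k ih =>
    rw [poch_succ]
    refine mul_ne_zero ih fun h => ?_
    have := congrArg Complex.re h
    simp only [Complex.add_re, Complex.natCast_re, Complex.zero_re] at this
    have : (0 : ℝ) ≤ k := k.cast_nonneg
    linarith

theorem Gamma_add_nat_eq_poch {x : ℂ} (hx : 0 < x.re) (k : ℕ) :
    Complex.Gamma (x + k) = poch x k * Complex.Gamma x := by
  induction k with
  | zero => simp [poch_zero]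
  | succ k ih =>
    have h : x + k ≠ 0 := fun h => by
      have := congrArg Complex.re h
      simp only [Complex.add_re, Complex.natCast_re, Complex.zero_re] at this
      have : (0 : ℝ) ≤ k := k.cast_nonneg
      linarith
    rw [poch_succ, Nat.cast_succ, ← add_assoc, Complex.Gamma_add_one _ h, ih]
    ring

theorem choose_eq_poch_div_factorial (b : ℂ) (k : ℕ) :
    Ring.choose (b + k - 1) k = poch b k / (k ! : ℂ) := by
  have h := Ring.factorial_nsmul_multichoose_eq_ascPochhammer b k
  rw [Polynomial.ascPochhammer_smeval_eq_eval, nsmul_eq_mul] at h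
  rw [poch, ← h, mul_div_cancel_left₀ _ (Nat.cast_ne_zero.mpr k.factorial_ne_zero), Ring.choose]
  congr 1
  ring

theorem hasSum_poch_one_sub_cpow (b : ℂ) {x : ℂ} (hx : ‖x‖ < 1) :
    HasSum (fun k : ℕ => poch b k / (k ! : ℂ) * x ^ k) ((1 - x) ^ (-b)) := by
  have h := (Complex.one_div_one_sub_cpow_hasFPowerSeriesOnBall_zero b).hasSum (y := x)
    (by simpa [enorm_eq_nnnorm, ← NNReal.coe_lt_coe] using hx)
  simp only [FormalMultilinearSeries.ofScalars_apply_eq, zero_add, smul_eq_mul,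
    choose_eq_poch_div_factorial] at h
  rwa [Complex.cpow_neg, ← one_div]

/-- The coefficients of `(1 - x) ^ (-b)`, for real `b < 1`, are summable against `1 / (k + 1)`:
eventually their norms `vₖ` satisfy `(1 - b) vₖ / (k + 1) = vₖ - vₖ₊₁`, which telescopes. -/
theorem summable_norm_poch_div_factorial_div {b : ℝ} (hb : b < 1) :
    Summable fun k : ℕ => ‖poch b k / (k ! : ℂ)‖ / (k + 1) := by
  obtain ⟨N, hN⟩ := exists_nat_ge (-b)
  set v : ℕ → ℝ := fun k => ‖poch b k / (k ! : ℂ)‖ with hv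
  have hrec (k : ℕ) (hk : N ≤ k) : v k / (k + 1) = (v k - v (k + 1)) / (1 - b) := by
    have hk' : (N : ℝ) ≤ k := by exact_mod_cast hk
    have h1 : (0 : ℝ) < k + 1 := by positivity
    have : v (k + 1) = v k * ((b + k) / (k + 1)) := by
      simp only [hv]
      rw [poch_succ, Nat.factorial_succ, Nat.cast_mul, mul_comm ((k + 1 : ℕ) : ℂ),
        mul_div_mul_comm, norm_mul]
      congr 1
      rw [show ((b : ℂ) + k) / ((k + 1 : ℕ) : ℂ) = (((b + k) / (k + 1) : ℝ) : ℂ) by push_cast; rfl,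
        Complex.norm_real, Real.norm_of_nonneg (div_nonneg (by linarith) h1.le)]
    have : 1 - b ≠ 0 := by linarith
    rw [‹v (k + 1) = _›]
    field_simp
    ring
  rw [← summable_nat_add_iff N]
  refine summable_of_sum_range_le (c := v N / (1 - b)) (fun n => by positivity) fun n => ?_
  rw [Finset.sum_congr rfl fun k _ => hrec (k + N) (Nat.le_add_left N k), ← Finset.sum_div]
  have hsum := Finset.sum_range_sub' (fun k => v (k + N)) n
  simp only [add_right_comm _ 1 N] at hsum
  rw [hsum, Nat.zero_add]
  have : 0 ≤ v (n + N) := norm_nonneg _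
  have : 0 < 1 - b := by linarith
  gcongr
  linarith

theorem hasSum_poch_div_add_eq_betaIntegral {s : ℂ} (hs : 0 < s.re) {b : ℝ} (hb : b < 1) :
    HasSum (fun k : ℕ => poch b k / (k ! : ℂ) / (s + k)) (Complex.betaIntegral s (1 - b)) := by
  set u : ℕ → ℂ := fun k => poch b k / (k ! : ℂ) with hu
  set F : ℕ → ℝ → ℂ := fun k x => u k * (x : ℂ) ^ (s + k - 1) with hF
  have hre (k : ℕ) : (s + k - 1).re = s.re + k - 1 := by simp
  have hexp (k : ℕ) : -1 < s.re + k - 1 := by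
    have : (0 : ℝ) ≤ k := k.cast_nonneg
    linarith
  have hint (k : ℕ) : Integrable (F k) (volume.restrict (Set.Ioc 0 1)) := by
    have := intervalIntegral.intervalIntegrable_cpow' (a := 0) (b := 1) (r := s + k - 1)
      (by rw [hre]; exact hexp k)
    exact ((intervalIntegrable_iff_integrableOn_Ioc_of_le zero_le_one).mp this).const_mul _
  have hval (k : ℕ) : ∫ x in Set.Ioc (0 : ℝ) 1, F k x = u k / (s + k) := by
    have hne : s + k ≠ 0 := fun h => by
      have := congrArg Complex.re h
      simp only [Complex.add_re, Complex.natCast_re, Complex.zero_re] at this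
      linarith [hexp k]
    rw [integral_const_mul, ← intervalIntegral.integral_of_le zero_le_one,
      integral_cpow (Or.inl (by rw [hre]; exact hexp k))]
    simp [Complex.zero_cpow hne, div_eq_mul_inv]
  have hnorm (k : ℕ) : ∫ x in Set.Ioc (0 : ℝ) 1, ‖F k x‖ = ‖u k‖ / (s.re + k) := by
    have h : Set.EqOn (fun x => ‖F k x‖) (fun x => ‖u k‖ * x ^ (s.re + k - 1)) (Set.Ioc 0 1) := by
      intro x hx
      simp only [hF, norm_mul, Complex.norm_cpow_eq_rpow_re_of_pos hx.1, hre]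
    have hne : s.re + k ≠ 0 := by linarith [hexp k]
    rw [setIntegral_congr_fun measurableSet_Ioc h, integral_const_mul,
      ← intervalIntegral.integral_of_le zero_le_one, integral_rpow (Or.inl (hexp k))]
    simp [Real.zero_rpow hne, div_eq_mul_inv]
  have hsum : Summable fun k => ∫ x in Set.Ioc (0 : ℝ) 1, ‖F k x‖ := by
    simp only [hnorm]
    refine ((summable_norm_poch_div_factorial_div hb).mul_left
      (max 1 s.re⁻¹)).of_nonneg_of_le (fun k => ?_) fun k => ?_
    · exact div_nonneg (norm_nonneg _) (by linarith [hexp k])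
    · have h0 : 0 < s.re + k := by linarith [hexp k]
      have h1 : (k : ℝ) + 1 ≤ max 1 s.re⁻¹ * (s.re + k) := by
        have h2 : s.re⁻¹ * s.re ≤ max 1 s.re⁻¹ * s.re := by gcongr; exact le_max_right _ _
        have h3 : 1 * (k : ℝ) ≤ max 1 s.re⁻¹ * k := by gcongr; exact le_max_left _ _
        rw [inv_mul_cancel₀ hs.ne'] at h2
        linarith
      rw [← mul_div_assoc, div_le_div_iff₀ h0 (by positivity)]
      calc ‖u k‖ * ((k : ℝ) + 1) ≤ ‖u k‖ * (max 1 s.re⁻¹ * (s.re + k)) := by gcongr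
        _ = _ := by ring
  have key := hasSum_integral_of_summable_integral_norm hint hsum
  simp only [hval] at key
  suffices h : Complex.betaIntegral s (1 - b) = ∫ x in Set.Ioc (0 : ℝ) 1, ∑' k, F k x by
    rwa [h]
  rw [Complex.betaIntegral, intervalIntegral.integral_of_le zero_le_one,
    integral_Ioc_eq_integral_Ioo, integral_Ioc_eq_integral_Ioo]
  refine setIntegral_congr_fun measurableSet_Ioo fun x hx => ?_
  have hx0 : (x : ℂ) ≠ 0 := Complex.ofReal_ne_zero.mpr hx.1.ne'
  have hx1 : ‖(x : ℂ)‖ < 1 := by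
    rw [Complex.norm_real, Real.norm_of_nonneg hx.1.le]; exact hx.2
  have h := ((hasSum_poch_one_sub_cpow b hx1).mul_left ((x : ℂ) ^ (s - 1))).tsum_eq
  rw [show (1 - (b : ℂ) - 1) = -b by ring, ← h]
  refine tsum_congr fun k => ?_
  simp only [hF, hu]
  rw [show s + k - 1 = (s - 1) + k by ring, Complex.cpow_add _ _ hx0, Complex.cpow_natCast]
  ring

theorem betaIntegral_add_half_self (m : ℕ) :
    (m + 1/2 : ℂ) * (m + 3/2) * Complex.betaIntegral (m + 1/2) (m + 1/2) / 2 =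
      3 * (Real.pi : ℂ) / (2 ^ (2 * m + 3) * (m ! : ℂ)) * poch (5/2) m := by
  have ha : 0 < (m + 1/2 : ℂ).re := by
    have : (m + 1/2 : ℂ) = ((m + 1/2 : ℝ) : ℂ) := by push_cast; rfl
    rw [this, Complex.ofReal_re]
    positivity
  have hne : (m + 1/2 : ℂ) ≠ 0 := fun h => by rw [h] at ha; simp at ha
  have hne' : (m + 1/2 + 1 : ℂ) ≠ 0 := fun h => by
    have := congrArg Complex.re h
    rw [Complex.add_re, Complex.one_re, Complex.zero_re] at this
    linarith
  have hpoch : (m + 1/2 : ℂ) * (m + 3/2) * Complex.Gamma (m + 1/2) =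
      poch (5/2) m * (3/4 * (Real.pi : ℂ) ^ (1/2 : ℂ)) := by
    have h1 : Complex.Gamma (5/2 + m) =
        (m + 1/2 + 1) * ((m + 1/2) * Complex.Gamma (m + 1/2)) := by
      rw [← Complex.Gamma_add_one _ hne, ← Complex.Gamma_add_one _ hne']
      congr 1
      ring
    have h2 : Complex.Gamma (5/2) = 3/4 * (Real.pi : ℂ) ^ (1/2 : ℂ) := by
      rw [show (5/2 : ℂ) = 1/2 + 1 + 1 by norm_num, Complex.Gamma_add_one _ (by norm_num),
        Complex.Gamma_add_one _ (by norm_num), Complex.Gamma_one_half_eq]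
      ring
    rw [Gamma_add_nat_eq_poch (by norm_num), h2] at h1
    rw [h1]
    ring
  have hpi : (Real.pi : ℂ) ^ (1/2 : ℂ) * ((√Real.pi : ℝ) : ℂ) = Real.pi := by
    rw [Real.sqrt_eq_rpow, Complex.ofReal_cpow Real.pi_pos.le]
    push_cast
    rw [← Complex.cpow_add _ _ (by exact_mod_cast Real.pi_ne_zero)]
    norm_num
  have hfac : (m ! : ℂ) ≠ 0 := Nat.cast_ne_zero.mpr m.factorial_ne_zero
  have hdup := Complex.Gamma_mul_Gamma_add_half (m + 1/2)
  rw [show (m + 1/2 + 1/2 : ℂ) = m + 1 by ring, Complex.Gamma_nat_eq_factorial,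
    show (1 - 2 * (m + 1/2) : ℂ) = -((2 * m : ℕ) : ℂ) by push_cast; ring, Complex.cpow_neg,
    Complex.cpow_natCast] at hdup
  have hbeta := Complex.Gamma_mul_Gamma_eq_betaIntegral ha ha
  rw [← two_mul (m + 1/2 : ℂ)] at hbeta
  have hG : Complex.Gamma (2 * (m + 1/2)) ≠ 0 := by
    refine Complex.Gamma_ne_zero_of_re_pos ?_
    rw [two_mul, Complex.add_re]
    linarith
  have hB : (m ! : ℂ) * 2 ^ (2 * m) * Complex.betaIntegral (m + 1/2) (m + 1/2) =
      Complex.Gamma (m + 1/2) * ((√Real.pi : ℝ) : ℂ) := by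
    refine mul_left_cancel₀ hG ?_
    have h2 : ((2 : ℂ) ^ (2 * m))⁻¹ * 2 ^ (2 * m) = 1 :=
      inv_mul_cancel₀ (pow_ne_zero _ two_ne_zero)
    linear_combination -(m ! : ℂ) * 2 ^ (2 * m) * hbeta +
      2 ^ (2 * m) * Complex.Gamma (m + 1/2) * hdup +
      Complex.Gamma (2 * (m + 1/2)) * Complex.Gamma (m + 1/2) * ((√Real.pi : ℝ) : ℂ) * h2
  rw [div_mul_eq_mul_div, div_eq_div_iff two_ne_zero (mul_ne_zero (pow_ne_zero _ two_ne_zero) hfac),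
    pow_add]
  linear_combination 8 * (m + 1/2 : ℂ) * (m + 3/2) * hB + 8 * ((√Real.pi : ℝ) : ℂ) * hpoch +
    6 * poch (5/2) m * hpi

theorem extended_gauss_pi_formula (m : ℕ) (d : ℂ) (hd : 0 < d.re) :
    hyp [1/2 + (m : ℂ), 1/2 - (m : ℂ), d + 1] [5/2 + (m : ℂ), d] 1 =
      (1 + (1 - 2 * (m : ℂ)) / (2 * d)) *
        (3 * (Real.pi : ℂ) / (2 ^ (2 * m + 3) * (m ! : ℂ))) * poch (5/2) m := by
  obtain ⟨a, ha⟩ : ∃ a : ℂ, a = m + 1/2 := ⟨_, rfl⟩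
  obtain ⟨b, hb⟩ : ∃ b : ℝ, b = 1/2 - m := ⟨_, rfl⟩
  have hb1 : b < 1 := by
    have : (0 : ℝ) ≤ m := m.cast_nonneg
    linarith
  have hbC : (b : ℂ) = 1/2 - m := by rw [hb]; push_cast; rfl
  have hab : (1 : ℂ) - b = a := by rw [hbC, ha]; ring
  have hare : 0 < a.re := by
    have := congrArg Complex.re hab
    simp only [Complex.sub_re, Complex.one_re, Complex.ofReal_re] at this
    linarith
  have hare1 : 0 < (a + 1).re := by rw [Complex.add_re, Complex.one_re]; linarith
  have hd0 : d ≠ 0 := fun h => by simp [h] at hd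
  have h1 := hasSum_poch_div_add_eq_betaIntegral hare hb1
  have h2 := hasSum_poch_div_add_eq_betaIntegral hare1 hb1
  rw [hab] at h1 h2
  have hrec : Complex.betaIntegral (a + 1) a = Complex.betaIntegral a a / 2 := by
    have ha0 : a ≠ 0 := fun h => by simp [h] at hare
    have h3 : Complex.betaIntegral a (a + 1) = Complex.betaIntegral (a + 1) a :=
      Complex.betaIntegral_symm _ _
    have hG := Complex.Gamma_mul_Gamma_eq_betaIntegral hare hare
    have hG' := Complex.Gamma_mul_Gamma_eq_betaIntegral hare1 hare
    have haa : a + a ≠ 0 := by rw [← two_mul]; exact mul_ne_zero two_ne_zero ha0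
    rw [add_right_comm, Complex.Gamma_add_one _ ha0, Complex.Gamma_add_one _ haa] at hG'
    have hne : Complex.Gamma (a + a) ≠ 0 :=
      Complex.Gamma_ne_zero_of_re_pos (by rw [Complex.add_re]; linarith)
    refine mul_left_cancel₀ (mul_ne_zero haa hne) ?_
    linear_combination -hG' + a * hG
  have hsum := ((h1.mul_left (1 - a / d)).sub (h2.mul_left (1 - (a + 1) / d))).mul_left
    (a * (a + 1))
  have hterm (k : ℕ) : ((([1/2 + (m : ℂ), 1/2 - (m : ℂ), d + 1].map (poch · k)).prod /
      ([5/2 + (m : ℂ), d].map (poch · k)).prod) * 1 ^ k / (k ! : ℂ)) =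
      a * (a + 1) * ((1 - a / d) * (poch b k / (k ! : ℂ) / (a + k)) -
        (1 - (a + 1) / d) * (poch b k / (k ! : ℂ) / (a + 1 + k))) := by
    have hk : (0 : ℝ) ≤ k := k.cast_nonneg
    have hak : a + k ≠ 0 := fun h => by
      have := congrArg Complex.re h
      simp only [Complex.add_re, Complex.natCast_re, Complex.zero_re] at this
      linarith
    have hak1 : a + 1 + k ≠ 0 := fun h => by
      have := congrArg Complex.re h
      simp only [Complex.add_re, Complex.one_re, Complex.natCast_re, Complex.zero_re] at this
      linarith
    have hp : poch (a + 2) k ≠ 0 := poch_ne_zero (by simp; linarith) k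
    have hpd : poch d k ≠ 0 := poch_ne_zero hd k
    have hfac : (k ! : ℂ) ≠ 0 := Nat.cast_ne_zero.mpr k.factorial_ne_zero
    have e1 := poch_succ' a k
    have e2 := poch_succ' (a + 1) k
    have e3 := poch_succ' d k
    rw [show a + 1 + 1 = a + 2 by ring] at e2
    have e4 : poch a k * (a + k) * (a + 1 + k) = a * (a + 1) * poch (a + 2) k := by
      linear_combination -(a + 1 + k) * e1 - a * e2
    have q1 : poch a k = a * (a + 1) * poch (a + 2) k / ((a + k) * (a + 1 + k)) := by
      rw [eq_div_iff (mul_ne_zero hak hak1)]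
      linear_combination e4
    have q2 : poch (d + 1) k = poch d k * (d + k) / d := by
      rw [eq_div_iff hd0]
      linear_combination e3
    simp only [List.map_cons, List.map_nil, List.prod_cons, List.prod_nil, mul_one, one_pow]
    rw [show (1/2 + m : ℂ) = a by rw [ha]; ring, ← hbC,
      show (5/2 + m : ℂ) = a + 2 by rw [ha]; ring, q1, q2]
    field_simp
    ring
  rw [hyp, tsum_congr hterm, hsum.tsum_eq, hrec, mul_assoc (1 + _), ← betaIntegral_add_half_self,
    ← ha, show (m + 3/2 : ℂ) = a + 1 by rw [ha]; ring,
    show (1 - 2 * m : ℂ) = 2 - 2 * a by rw [ha]; ring]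
  field_simp
  ring
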